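/- Let A, B be multiplicative characters on F_q with A ≠ ε and A ≠ B, and let x ∈ F_q with x ≠ 1. Then ₂F₁*(A, B; A | x) = ε(x)·B̄(1-x) - (1/q)·(B choose A)⁻¹·Ā(-x), where ε is the trivial character (so ε(x) = 1 for x ≠ 0 and ε(0) = 0). -/

import Mathlib

/-- Multiplicative characters of a finite field with values in `ℂ` form a finite type. -/
noncomputable instance mulCharFintypeC (F : Type*) [Field F] [Fintype F] :
    Fintype (MulChar F ℂ) :=
  Fintype.ofFinite _

/-- The canonical additive character `θ(α) = ζ^{tr(α)}` of a finite field `F` of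
characteristic `p`, where `ζ` is a fixed primitive `p`-th root of unity in `ℂ`
and `tr` is the trace map to `ZMod p = F_p`. -/
noncomputable def addCharTheta (p : ℕ) (F : Type*) [Field F] [Fintype F]
    [Algebra (ZMod p) F] (zeta : ℂ) (a : F) : ℂ :=
  zeta ^ (Algebra.trace (ZMod p) F a).val

/-- The Gauss sum `g(χ) = ∑_{x ∈ F} χ(x) θ(x)`. -/
noncomputable def gaussS (p : ℕ) (F : Type*) [Field F] [Fintype F]
    [Algebra (ZMod p) F] (zeta : ℂ) (χ : MulChar F ℂ) : ℂ :=
  ∑ x : F, χ x * addCharTheta p F zeta x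

/-- McCarthy's finite field hypergeometric function
`₂F₁*(A₀, A₁; B₁ | x) = (1/(q-1)) ∑_χ [g(A₀χ)g(A₁χ)g((B₁χ)⁻¹)g(χ⁻¹)/(g(A₀)g(A₁)g(B₁⁻¹))] χ(x)`. -/
noncomputable def mcCarthy2F1 (p : ℕ) (F : Type*) [Field F] [Fintype F]
    [Algebra (ZMod p) F] (zeta : ℂ) (A₀ A₁ B₁ : MulChar F ℂ) (x : F) : ℂ :=
  (1 / ((Fintype.card F : ℂ) - 1)) * ∑ χ : MulChar F ℂ,
    gaussS p F zeta (A₀ * χ) * gaussS p F zeta (A₁ * χ) * gaussS p F zeta (B₁ * χ)⁻¹ *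
      gaussS p F zeta χ⁻¹ /
        (gaussS p F zeta A₀ * gaussS p F zeta A₁ * gaussS p F zeta B₁⁻¹) * χ x

/-- The finite field Appell function `F₄*(A; B; C, C'; x, y)`. -/
noncomputable def appellF4star (p : ℕ) (F : Type*) [Field F] [Fintype F]
    [Algebra (ZMod p) F] (zeta : ℂ) (A B C C' : MulChar F ℂ) (x y : F) : ℂ :=
  (1 / ((Fintype.card F : ℂ) - 1) ^ 2) * ∑ ψ : MulChar F ℂ, ∑ χ : MulChar F ℂ,
    gaussS p F zeta (A * χ * ψ) * gaussS p F zeta (B * χ * ψ) * gaussS p F zeta (C * ψ)⁻¹ *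
      gaussS p F zeta (C' * χ)⁻¹ * gaussS p F zeta ψ⁻¹ * gaussS p F zeta χ⁻¹ /
        (gaussS p F zeta A * gaussS p F zeta B * gaussS p F zeta C⁻¹ *
          gaussS p F zeta C'⁻¹) *
      (ψ x * χ y)

/-- The finite field Appell function `F₁*(A; B, B'; C; x, y)`. -/
noncomputable def appellF1star (p : ℕ) (F : Type*) [Field F] [Fintype F]
    [Algebra (ZMod p) F] (zeta : ℂ) (A B B' C : MulChar F ℂ) (x y : F) : ℂ :=
  (1 / ((Fintype.card F : ℂ) - 1) ^ 2) * ∑ ψ : MulChar F ℂ, ∑ χ : MulChar F ℂ,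
    gaussS p F zeta (A * χ * ψ) * gaussS p F zeta (B * ψ) * gaussS p F zeta (B' * χ) *
      gaussS p F zeta (C * χ * ψ)⁻¹ * gaussS p F zeta ψ⁻¹ * gaussS p F zeta χ⁻¹ /
        (gaussS p F zeta A * gaussS p F zeta B * gaussS p F zeta B' *
          gaussS p F zeta C⁻¹) *
      (ψ x * χ y)

/-- The Jacobi sum `J(A,B) = ∑_{x ∈ F} A(x) B(1-x)`. -/
noncomputable def jacobiS (F : Type*) [Field F] [Fintype F] (A B : MulChar F ℂ) : ℂ :=
  ∑ x : F, A x * B (1 - x)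

/-- Greene's binomial coefficient `(A choose B) = (B(-1)/q) J(A, B⁻¹)`. -/
noncomputable def binomChar (F : Type*) [Field F] [Fintype F] (A B : MulChar F ℂ) : ℂ :=
  (B (-1) / (Fintype.card F : ℂ)) * jacobiS F A B⁻¹

open AddChar in
/-- The character `θ` bundled as an additive character. -/
noncomputable def thetaAddChar (p : ℕ) [Fact p.Prime] (F : Type*) [Field F] [Fintype F]
    [Algebra (ZMod p) F] {zeta : ℂ} (hzeta : IsPrimitiveRoot zeta p) : AddChar F ℂ :=
  (zmodChar p hzeta.pow_eq_one).compAddMonoidHom (Algebra.trace (ZMod p) F).toAddMonoidHom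

lemma gaussS_eq_gaussSum (p : ℕ) [Fact p.Prime] (F : Type*) [Field F] [Fintype F]
    [Algebra (ZMod p) F] {zeta : ℂ} (hzeta : IsPrimitiveRoot zeta p) (χ : MulChar F ℂ) :
    gaussS p F zeta χ = gaussSum χ (thetaAddChar p F hzeta) :=
  rfl

lemma thetaAddChar_ne_one (p : ℕ) [Fact p.Prime] (F : Type*) [Field F] [Fintype F]
    [Algebra (ZMod p) F] {zeta : ℂ} (hzeta : IsPrimitiveRoot zeta p) :
    thetaAddChar p F hzeta ≠ 1 := by
  obtain ⟨a, ha⟩ := Algebra.trace_surjective (ZMod p) F 1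
  refine AddChar.ne_one_iff.2 ⟨a, fun h => ?_⟩
  have h1 : AddChar.zmodChar p hzeta.pow_eq_one (Algebra.trace (ZMod p) F a) = 1 := h
  exact one_ne_zero (ha ▸ ((AddChar.zmodChar_primitive_of_primitive_root p hzeta).zmod_char_eq_one_iff
    p _).1 h1)

namespace MulChar

variable {F : Type*} [Field F] [Fintype F]

open Classical in
/-- Orthogonality: the sum of `χ a` over all multiplicative characters `χ` of `F`. -/
lemma sum_apply_eq_ite (a : F) :
    ∑ χ : MulChar F ℂ, χ a = if a = 1 then (Fintype.card F : ℂ) - 1 else 0 := by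
  split_ifs with ha
  · have hcard : Fintype.card (MulChar F ℂ) = Fintype.card F - 1 := by
      rw [← Nat.card_eq_fintype_card, card_eq_card_units_of_hasEnoughRootsOfUnity,
        Nat.card_units, Nat.card_eq_fintype_card]
    simp [ha, hcard, Nat.cast_sub Fintype.card_pos]
  · obtain ⟨χ, hχ⟩ := exists_apply_ne_one_of_hasEnoughRootsOfUnity F ℂ ha
    refine eq_zero_of_mul_eq_self_left hχ ?_
    simp only [Finset.mul_sum, ← mul_apply]
    exact Fintype.sum_bijective _ (Group.mulLeft_bijective χ) _ _ fun _ ↦ rfl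

end MulChar

section GaussSum

variable {F : Type*} [Field F] [Fintype F]

lemma gaussSum_mul_gaussSum_inv {χ : MulChar F ℂ} (hχ : χ ≠ 1) {ψ : AddChar F ℂ} (hψ : ψ ≠ 1) :
    gaussSum χ ψ * gaussSum χ⁻¹ ψ = χ (-1) * Fintype.card F := by
  have hinv : χ⁻¹ (-1) = χ (-1) := by rw [MulChar.inv_apply', inv_neg_one]
  rw [← mul_gaussSum_inv_eq_gaussSum χ⁻¹, hinv, mul_left_comm,
    gaussSum_mul_gaussSum_eq_card hχ (AddChar.IsPrimitive.of_ne_one hψ)]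

open Classical in
lemma gaussSum_mul_gaussSum_inv_eq_ite (χ : MulChar F ℂ) {ψ : AddChar F ℂ} (hψ : ψ ≠ 1) :
    gaussSum χ ψ * gaussSum χ⁻¹ ψ =
      χ (-1) * Fintype.card F - if χ = 1 then (Fintype.card F : ℂ) - 1 else 0 := by
  split_ifs with h
  · rw [h, inv_one, gaussSum_one_left hψ, MulChar.one_apply (isUnit_one.neg)]
    ring
  · rw [gaussSum_mul_gaussSum_inv h hψ, sub_zero]

/-- The finite field binomial theorem, in terms of Gauss sums. -/
lemma sum_gaussSum_mul_gaussSum_inv_mul_apply (B : MulChar F ℂ) (ψ : AddChar F ℂ) {x : F}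
    (hx0 : x ≠ 0) (hx1 : x ≠ 1) :
    ∑ χ : MulChar F ℂ, gaussSum (B * χ) ψ * gaussSum χ⁻¹ ψ * χ (-x) =
      ((Fintype.card F : ℂ) - 1) * (B⁻¹ (1 - x) * gaussSum B ψ) := by
  classical
  have hshift (χ : MulChar F ℂ) (c : F) (hc : c ≠ 0) :
      gaussSum χ (ψ.mulShift c) = χ⁻¹ c * gaussSum χ ψ :=
    gaussSum_mulShift_eq χ ψ (Units.mk0 c hc)
  have hterm (χ : MulChar F ℂ) : gaussSum (B * χ) ψ * gaussSum χ⁻¹ ψ * χ (-x) =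
      ∑ a, ∑ b, B a * (ψ a * ψ (-x * b)) * χ (a * b⁻¹) := by
    have h := hshift χ⁻¹ (-x) (neg_ne_zero.2 hx0)
    rw [inv_inv] at h
    rw [mul_assoc, mul_comm (gaussSum χ⁻¹ ψ), ← h, gaussSum, gaussSum, Finset.sum_mul_sum]
    refine Finset.sum_congr rfl fun a _ => Finset.sum_congr rfl fun b _ => ?_
    rw [MulChar.mul_apply, MulChar.inv_apply', AddChar.mulShift_apply, map_mul χ]
    ring
  have hite (a b : F) : B a * (ψ a * ψ (-x * b)) *
        (if a * b⁻¹ = 1 then (Fintype.card F : ℂ) - 1 else 0) =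
      if a = b then ((Fintype.card F : ℂ) - 1) * (B a * ψ ((1 - x) * a)) else 0 := by
    rcases eq_or_ne a 0 with rfl | ha
    · simp [MulChar.map_zero]
    · by_cases hab : a = b
      · subst hab
        rw [if_pos (mul_inv_cancel₀ ha), if_pos rfl, ← AddChar.map_add_eq_mul,
          show a + -x * a = (1 - x) * a by ring]
        ring
      · have hne : a * b⁻¹ ≠ 1 := fun h => hab (eq_of_div_eq_one (div_eq_mul_inv a b ▸ h))
        rw [if_neg hne, if_neg hab, mul_zero]
  calc ∑ χ : MulChar F ℂ, gaussSum (B * χ) ψ * gaussSum χ⁻¹ ψ * χ (-x)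
      = ∑ a, ∑ b, B a * (ψ a * ψ (-x * b)) * ∑ χ : MulChar F ℂ, χ (a * b⁻¹) := by
        simp_rw [hterm, Finset.mul_sum]
        rw [Finset.sum_comm]
        exact Finset.sum_congr rfl fun a _ => Finset.sum_comm
    _ = ((Fintype.card F : ℂ) - 1) * gaussSum B (ψ.mulShift (1 - x)) := by
        simp_rw [MulChar.sum_apply_eq_ite, hite]
        simp [gaussSum, Finset.mul_sum, AddChar.mulShift_apply]
    _ = _ := by rw [hshift B (1 - x) (sub_ne_zero.2 hx1.symm)]

end GaussSum

theorem stmt10    (p : ℕ) [Fact p.Prime] (hp : p ≠ 2) (F : Type*) [Field F] [Fintype F]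
    [Algebra (ZMod p) F] (zeta : ℂ) (hzeta : IsPrimitiveRoot zeta p)
    (A B : MulChar F ℂ) (hA : A ≠ 1) (hAB : A ≠ B) (x : F) (hx : x ≠ 1) :
    mcCarthy2F1 p F zeta A B A x =
    (1 : MulChar F ℂ) x * B⁻¹ (1 - x) -
      (1 / (Fintype.card F : ℂ)) * (binomChar F B A)⁻¹ * A⁻¹ (-x) := by
  classical
  rcases eq_or_ne x 0 with rfl | hx0
  · simp [mcCarthy2F1, MulChar.map_zero]
  set ψ := thetaAddChar p F hzeta
  have hψ : ψ ≠ 1 := thetaAddChar_ne_one p F hzeta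
  have hq : (Fintype.card F : ℂ) ≠ 0 := Nat.cast_ne_zero.2 Fintype.card_ne_zero
  have hq1 : (Fintype.card F : ℂ) - 1 ≠ 0 :=
    sub_ne_zero.2 (by exact_mod_cast (Fintype.one_lt_card (α := F)).ne')
  have hg (χ : MulChar F ℂ) : gaussSum χ ψ ≠ 0 := by
    by_cases h : χ = 1
    · simp [h, gaussSum_one_left hψ]
    · exact gaussSum_ne_zero_of_nontrivial hq h (AddChar.IsPrimitive.of_ne_one hψ)
  have hBA : B * A⁻¹ ≠ 1 := fun h => hAB (mul_inv_eq_one.1 h).symm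
  have hsq : A (-1) * A (-1) = 1 := by rw [← map_mul]; simp
  have hA1 : A (-1) ≠ 0 := left_ne_zero_of_mul_eq_one hsq
  have hAA := gaussSum_mul_gaussSum_inv hA hψ
  have hJ : jacobiS F B A⁻¹ = gaussSum B ψ * gaussSum A⁻¹ ψ / gaussSum (B * A⁻¹) ψ :=
    jacobiSum_eq_gaussSum_mul_gaussSum_div_gaussSum hq hBA (AddChar.IsPrimitive.of_ne_one hψ)
  have hneg (χ : MulChar F ℂ) : χ (-x) = χ (-1) * χ x := by rw [← map_mul, neg_one_mul]
  have hsum : ∑ χ : MulChar F ℂ, gaussSum (A * χ) ψ * gaussSum (B * χ) ψ *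
        gaussSum (A * χ)⁻¹ ψ * gaussSum χ⁻¹ ψ * χ x =
      A (-1) * Fintype.card F * (((Fintype.card F : ℂ) - 1) * (B⁻¹ (1 - x) * gaussSum B ψ)) -
        ((Fintype.card F : ℂ) - 1) * (gaussSum (B * A⁻¹) ψ * gaussSum A ψ * A⁻¹ x) := by
    have hterm (χ : MulChar F ℂ) : gaussSum (A * χ) ψ * gaussSum (B * χ) ψ *
          gaussSum (A * χ)⁻¹ ψ * gaussSum χ⁻¹ ψ * χ x =
        A (-1) * Fintype.card F * (gaussSum (B * χ) ψ * gaussSum χ⁻¹ ψ * χ (-x)) -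
          if χ = A⁻¹ then
            ((Fintype.card F : ℂ) - 1) * (gaussSum (B * χ) ψ * gaussSum χ⁻¹ ψ * χ x) else 0 := by
      have h := gaussSum_mul_gaussSum_inv_eq_ite (A * χ) hψ
      simp only [mul_eq_one_iff_inv_eq, eq_comm (a := A⁻¹), MulChar.mul_apply] at h
      rw [mul_right_comm (gaussSum (A * χ) ψ), h, hneg]
      split_ifs <;> ring
    simp_rw [hterm, Finset.sum_sub_distrib, ← Finset.mul_sum,
      sum_gaussSum_mul_gaussSum_inv_mul_apply B ψ hx0 hx]
    simp
  have hone : (1 : MulChar F ℂ) x = 1 := MulChar.one_apply hx0.isUnit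
  have hinv : A⁻¹ (-x) = A (-1) * A⁻¹ x := by
    rw [hneg, MulChar.inv_apply', inv_neg_one]
  have hLHS : mcCarthy2F1 p F zeta A B A x = 1 / ((Fintype.card F : ℂ) - 1) *
      ((∑ χ : MulChar F ℂ, gaussSum (A * χ) ψ * gaussSum (B * χ) ψ *
        gaussSum (A * χ)⁻¹ ψ * gaussSum χ⁻¹ ψ * χ x) /
          (A (-1) * Fintype.card F * gaussSum B ψ)) := by
    rw [← hAA, mcCarthy2F1, Finset.sum_div]
    simp_rw [gaussS_eq_gaussSum p F hzeta]
    refine congrArg _ (Finset.sum_congr rfl fun χ _ => ?_)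
    rw [mul_right_comm (gaussSum A ψ), div_mul_eq_mul_div]
  have hA' : gaussSum A⁻¹ ψ = A (-1) * Fintype.card F / gaussSum A ψ := by
    rw [← hAA, mul_div_cancel_left₀ _ (hg A)]
  rw [hLHS, hsum, binomChar, hJ, hone, hinv, hA']
  have hgA := hg A
  have hgB := hg B
  have hgBA := hg (B * A⁻¹)
  field_simp
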